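/- Let k be a field, let d ≥ 1 and e ≥ 0 be integers, and let Δ, f₁,…,f_d ∈ k[[t]][x₁,…,x_d]. Set R₂ = k[[t]][x₁,…,x_d,z]/(zΔ − t^e), and regard R₂ as an algebra over R₁ = k[[t]][u₁,…,u_d] via the k[[t]]-algebra homomorphism sending u_j to z̄·f̄_j (the image of z·f_j in R₂) for j = 1,…,d. Then the 0-th Fitting ideal of the R₂-module Ω_{R₂/R₁} is the principal ideal of R₂ generated by the image of z^d·det N, where N is the (d+1)×(d+1) matrix over k[[t]][x₁,…,x_d,z] with entries N_{i,j} = ∂f_j/∂x_i and N_{i,d+1} = ∂Δ/∂x_i for 1 ≤ i ≤ d, 1 ≤ j ≤ d, and last row N_{d+1,j} = f_j (1 ≤ j ≤ d), N_{d+1,d+1} = Δ. -/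

import Mathlib

open MvPolynomial

/-- The `i`-th Fitting ideal of an `R`-module `M`: the ideal generated by the
`(n-i)×(n-i)` minors of (matrices of) relations of any `n`-generator presentation of `M`
(here formulated via a supremum over all surjections from finite free modules; for a
finitely presented module this agrees with the classical definition for every presentation,
by independence of the Fitting ideal from the chosen presentation). -/
noncomputable def fittingIdeal (R : Type*) [CommRing R] (M : Type*) [AddCommGroup M]
    [Module R M] (i : ℕ) : Ideal R :=
  ⨆ (n : ℕ) (f : (Fin n → R) →ₗ[R] M) (_ : Function.Surjective f),
    Ideal.span { x : R | ∃ (v : Fin (n - i) → (Fin n → R)) (c : Fin (n - i) → Fin n),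
      (∀ j, f (v j) = 0) ∧ x = (Matrix.of (fun j l => v j (c l))).det }

/-- The ideal `(zΔ - t^e)` of `k[[t]][x₁,…,x_d,z]`, where the variable `z` is indexed by
`none : Option (Fin d)` and `x_i` by `some i`. -/
noncomputable def relIdeal (k : Type u) [Field k] (d e : ℕ)
    (Δ : MvPolynomial (Fin d) (PowerSeries k)) :
    Ideal (MvPolynomial (Option (Fin d)) (PowerSeries k)) :=
  Ideal.span {X none * rename some Δ - C (PowerSeries.X ^ e)}

/-- The `(d+1)×(d+1)` matrix over `k[[t]][x₁,…,x_d]` with entries `N_{i,j} = ∂f_j/∂x_i`,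
`N_{i,d+1} = ∂Δ/∂x_i` for `1 ≤ i,j ≤ d`, and last row `(f₁, …, f_d, Δ)`. -/
noncomputable def jacMat (k : Type u) [Field k] (d : ℕ)
    (Δ : MvPolynomial (Fin d) (PowerSeries k)) (f : Fin d → MvPolynomial (Fin d) (PowerSeries k)) :
    Matrix (Fin (d + 1)) (Fin (d + 1)) (MvPolynomial (Fin d) (PowerSeries k)) :=
  Matrix.of fun i j =>
    Fin.lastCases
      (Fin.lastCases Δ (fun j' => f j') j)
      (fun i' => Fin.lastCases (pderiv i' Δ) (fun j' => pderiv i' (f j')) j) i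


section FittingGeneral

variable {R : Type*} [CommRing R] {M : Type*} [AddCommGroup M] [Module R M]

lemma exists_lift_matrix {n m : Type*} [Fintype n] [Fintype m] [DecidableEq n]
    (f : (n → R) →ₗ[R] M) (g : (m → R) →ₗ[R] M) (hg : Function.Surjective g) :
    ∃ A : Matrix n m R, ∀ a, g (Matrix.vecMul a A) = f a := by
  choose A hA using fun i => hg (f (Pi.single i 1))
  refine ⟨Matrix.of A, fun a => ?_⟩
  have h1 : Matrix.vecMul a (Matrix.of A) = ∑ i, a i • A i := by
    ext j; simp [Matrix.vecMul, dotProduct]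
  rw [h1, map_sum]
  conv_rhs => rw [pi_eq_sum_univ' a, map_sum]
  refine Finset.sum_congr rfl fun i _ => ?_
  rw [map_smul, map_smul, hA]

lemma det_dvd_of_presentation {n m : Type*} [Fintype n] [Fintype m] [DecidableEq n]
    [DecidableEq m]
    (f : (n → R) →ₗ[R] M) (hf : Function.Surjective f)
    (g : (m → R) →ₗ[R] M) (hg : Function.Surjective g)
    (P : Matrix m m R) (hP : ∀ b, g b = 0 → ∃ s, b = Matrix.vecMul s P)
    (V : Matrix n n R) (hV : ∀ i, f (V i) = 0) : P.det ∣ V.det := by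
  obtain ⟨A, hA⟩ := exists_lift_matrix f g hg
  obtain ⟨B, hB⟩ := exists_lift_matrix g f hf
  have h1 : ∀ i, ∃ s, (V * A) i = Matrix.vecMul s P := fun i => hP _ (by
    rw [Matrix.mul_apply_eq_vecMul, hA, hV])
  have h2 : ∀ i, ∃ s, (1 - B * A : Matrix m m R) i = Matrix.vecMul s P := fun i => hP _ (by
    have : (1 - B * A : Matrix m m R) i = (1 : Matrix m m R) i - Matrix.vecMul (B i) A := by
      rw [← Matrix.mul_apply_eq_vecMul]; rfl
    rw [this, map_sub, hA, sub_eq_zero, ← hB]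
    congr 1
    rw [← Matrix.mul_apply_eq_vecMul]
    exact congrFun (Matrix.one_mul B) i)
  choose S1 hS1 using h1
  choose S2 hS2 using h2
  have e1 : V * A = Matrix.of S1 * P := by
    funext i; rw [hS1, Matrix.mul_apply_eq_vecMul]; rfl
  have e2 : 1 - B * A = Matrix.of S2 * P := by
    funext i; rw [hS2, Matrix.mul_apply_eq_vecMul]; rfl
  have key : Matrix.fromBlocks V 0 (-B) 1 =
      Matrix.fromBlocks V (Matrix.of S1) (-B) (Matrix.of S2) * Matrix.fromBlocks 1 (-A) 0 P := by
    rw [Matrix.fromBlocks_multiply, ← e1, ← e2]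
    simp
  have := congrArg Matrix.det key
  rw [Matrix.det_mul, Matrix.det_fromBlocks_zero₁₂, Matrix.det_fromBlocks_zero₂₁] at this
  simp only [Matrix.det_one, mul_one, one_mul] at this
  exact ⟨_, by rw [this, mul_comm]⟩

lemma fittingIdeal_eq_of_presentation {m : Type*} [Fintype m] [DecidableEq m]
    (g : (m → R) →ₗ[R] M) (hg : Function.Surjective g)
    (P : Matrix m m R) (hP : ∀ b, g b = 0 → ∃ s, b = Matrix.vecMul s P)
    (hP' : ∀ i, g (P i) = 0) : fittingIdeal R M 0 = Ideal.span {P.det} := by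
  apply le_antisymm
  · refine iSup_le fun n => iSup_le fun f => iSup_le fun hf => ?_
    rw [Ideal.span_le]
    rintro x ⟨v, c, hv, rfl⟩
    rw [SetLike.mem_coe, Ideal.mem_span_singleton]
    have h := det_dvd_of_presentation f hf g hg P hP (Matrix.of v) hv
    have e : (Matrix.of (fun j l => v j (c l)) : Matrix (Fin n) (Fin n) R) =
        Matrix.of v * Matrix.of (fun i l => if i = c l then 1 else 0) := by
      ext j l
      simp [Matrix.mul_apply]
    have h2 : P.det ∣ (Matrix.of (fun j l => v j (c l)) : Matrix (Fin n) (Fin n) R).det := by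
      rw [e, Matrix.det_mul]
      exact h.mul_right _
    exact h2
  · let ε := Fintype.equivFin m
    let L : (Fin (Fintype.card m) → R) ≃ₗ[R] (m → R) := LinearEquiv.funCongrLeft R R ε
    refine le_trans ?_ (le_iSup_of_le (Fintype.card m) (le_iSup_of_le (g ∘ₗ L.toLinearMap)
      (le_iSup_of_le (hg.comp L.surjective) le_rfl)))
    rw [Ideal.span_le, Set.singleton_subset_iff]
    refine Ideal.subset_span ⟨fun j l => P (ε.symm j) (ε.symm l), id, fun j => ?_, ?_⟩
    · rw [← hP' (ε.symm j)]
      change g _ = _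
      congr 1
      ext l
      simp [L, LinearEquiv.funCongrLeft, LinearMap.funLeft_apply]
    · exact (Matrix.det_submatrix_equiv_self ε.symm P).symm

end FittingGeneral

section Kaehler

variable {A R B : Type*} [CommRing A] [CommRing R] [CommRing B] {ι : Type*}
  [Algebra (MvPolynomial ι A) R] [Algebra B R]

variable (R) in
/-- gradient -/
noncomputable def gradR (p : MvPolynomial ι A) : ι → R :=
  fun i => algebraMap (MvPolynomial ι A) R (pderiv i p)

lemma gradR_add (p q : MvPolynomial ι A) : gradR R (p + q) = gradR R p + gradR R q := by
  ext i; simp [gradR]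

lemma gradR_sub (p q : MvPolynomial ι A) : gradR R (p - q) = gradR R p - gradR R q := by
  ext i; simp [gradR]

lemma gradR_mul (p q : MvPolynomial ι A) : gradR R (p * q) =
    algebraMap _ R p • gradR R q + algebraMap _ R q • gradR R p := by
  ext i; simp [gradR, Derivation.leibniz, Algebra.smul_def]

lemma gradR_C (a : A) : gradR R (C a : MvPolynomial ι A) = 0 := by
  ext i; simp [gradR]

lemma gradR_X [DecidableEq ι] (i : ι) : gradR R (X i : MvPolynomial ι A) = Pi.single i 1 := by
  ext j; by_cases h : j = i
  · subst h; simp [gradR]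
  · simp [gradR, h, pderiv_X_of_ne (Ne.symm h)]

variable [Fintype ι]

variable (A R B ι) in
/-- the presentation map -/
noncomputable def presMap : (ι → R) →ₗ[R] KaehlerDifferential B R :=
  Fintype.linearCombination R
    (fun i : ι => KaehlerDifferential.D B R (algebraMap (MvPolynomial ι A) R (X i)))

variable [DecidableEq ι]

lemma presMap_grad (h : B →+* MvPolynomial ι A)
    (hh : ∀ b, algebraMap B R b = algebraMap (MvPolynomial ι A) R (h b))
    (hC : ∀ a, ∃ b, h b = C a)
    (p : MvPolynomial ι A) :
    presMap A R B ι (gradR R p) = KaehlerDifferential.D B R (algebraMap _ R p) := by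
  induction p using MvPolynomial.induction_on with
  | C a =>
    obtain ⟨b, hb⟩ := hC a
    rw [gradR_C, map_zero, ← hb, ← hh, Derivation.map_algebraMap]
  | add p q hp hq => rw [gradR_add, map_add, hp, hq, map_add, map_add]
  | mul_X p i hp =>
    rw [gradR_mul, map_add, map_smul, map_smul, hp, gradR_X, map_mul, Derivation.leibniz]
    congr 2
    simp [presMap, Fintype.linearCombination_apply_single]

lemma presMap_surjective (h : B →+* MvPolynomial ι A)
    (hh : ∀ b, algebraMap B R b = algebraMap (MvPolynomial ι A) R (h b))
    (hC : ∀ a, ∃ b, h b = C a)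
    (hs : Function.Surjective (algebraMap (MvPolynomial ι A) R))
    : Function.Surjective (presMap A R B ι) := by
  rw [← LinearMap.range_eq_top, ← top_le_iff, ← KaehlerDifferential.span_range_derivation,
    Submodule.span_le]
  rintro _ ⟨x, rfl⟩
  obtain ⟨p, rfl⟩ := hs x
  exact ⟨_, presMap_grad h hh hC p⟩

lemma presMap_ker (h : B →+* MvPolynomial ι A)
    (hh : ∀ b, algebraMap B R b = algebraMap (MvPolynomial ι A) R (h b))
    (hs : Function.Surjective (algebraMap (MvPolynomial ι A) R))
    (K : Submodule R (ι → R))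
    (hK1 : ∀ p : MvPolynomial ι A, algebraMap _ R p = 0 → gradR R p ∈ K)
    (hK2 : ∀ b, gradR R (h b) ∈ K) (v : ι → R) (hv : presMap A R B ι v = 0) : v ∈ K := by
  let σ := Function.surjInv hs
  have hσ : ∀ r, algebraMap (MvPolynomial ι A) R (σ r) = r := Function.surjInv_eq hs
  have key : ∀ p q : MvPolynomial ι A, algebraMap _ R p = algebraMap _ R q →
      K.mkQ (gradR R p) = K.mkQ (gradR R q) := fun p q hpq => by
    rw [← sub_eq_zero, ← map_sub, ← gradR_sub]
    exact (Submodule.Quotient.mk_eq_zero K).2 (hK1 _ (by rw [map_sub, hpq, sub_self]))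
  have hmul : ∀ a b : R, K.mkQ (gradR R (σ (a * b))) =
      a • K.mkQ (gradR R (σ b)) + b • K.mkQ (gradR R (σ a)) := fun a b => by
    rw [key (σ (a * b)) (σ a * σ b) (by rw [map_mul, hσ, hσ, hσ]), gradR_mul, map_add, map_smul,
      map_smul, hσ, hσ]
  let D' : Derivation B R ((ι → R) ⧸ K) := Derivation.mk'
    { toFun := fun r => K.mkQ (gradR R (σ r))
      map_add' := fun a b => by
        rw [key (σ (a + b)) (σ a + σ b) (by rw [map_add, hσ, hσ, hσ]), gradR_add, map_add]
      map_smul' := fun b r => by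
        rw [Algebra.smul_def, hmul, key (σ (algebraMap B R b)) (h b) (by rw [hσ, hh])]
        rw [show K.mkQ (gradR R (h b)) = 0 from (Submodule.Quotient.mk_eq_zero K).2 (hK2 b),
          smul_zero, add_zero, algebraMap_smul]
        rfl } hmul
  have hD' : D'.liftKaehlerDifferential ∘ₗ presMap A R B ι = K.mkQ := by
    refine LinearMap.pi_ext' fun i => LinearMap.ext_ring ?_
    simp only [LinearMap.comp_apply, LinearMap.single_apply, presMap,
      Fintype.linearCombination_apply_single, one_smul, Derivation.liftKaehlerDifferential_comp_D]
    change K.mkQ (gradR R (σ _)) = _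
    rw [key _ (X i) (hσ _), gradR_X]
  have := LinearMap.congr_fun hD' v
  rw [LinearMap.comp_apply, hv, map_zero] at this
  exact (Submodule.Quotient.mk_eq_zero K).1 this.symm

lemma fitting_kaehler_aux (h : B →+* MvPolynomial ι A)
    (hh : ∀ b, algebraMap B R b = algebraMap (MvPolynomial ι A) R (h b))
    (hC : ∀ a, ∃ b, h b = C a)
    (hs : Function.Surjective (algebraMap (MvPolynomial ι A) R))
    (F : ι → MvPolynomial ι A) (o : ι)
    (ho : algebraMap _ R (F o) = 0)
    (hker : ∀ p : MvPolynomial ι A, algebraMap _ R p = 0 → ∃ q, q * F o = p)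
    (hF : ∀ r, r ≠ o → ∃ b, h b = F r)
    (hspan : ∀ b, gradR R (h b) ∈ Submodule.span R (Set.range fun r => gradR R (F r))) :
    fittingIdeal R (KaehlerDifferential B R) 0 =
      Ideal.span {algebraMap (MvPolynomial ι A) R
        (Matrix.of fun r i => pderiv i (F r)).det} := by
  have hdet : algebraMap (MvPolynomial ι A) R (Matrix.of fun r i => pderiv i (F r)).det =
      (Matrix.of fun r => gradR R (F r)).det := by
    rw [RingHom.map_det]
    rfl
  rw [hdet]
  refine fittingIdeal_eq_of_presentation (presMap A R B ι) (presMap_surjective h hh hC hs) _ ?_ ?_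
  · intro b hb
    have := presMap_ker h hh hs _ ?_ hspan b hb
    · obtain ⟨s, hs⟩ := (Submodule.mem_span_range_iff_exists_fun R).1 this
      refine ⟨s, ?_⟩
      rw [← hs]
      ext j
      simp [Matrix.vecMul, dotProduct]
    · intro p hp
      obtain ⟨q, rfl⟩ := hker p hp
      rw [gradR_mul, ho, zero_smul, add_zero]
      exact Submodule.smul_mem _ _ (Submodule.subset_span ⟨o, rfl⟩)
  · intro r
    change presMap A R B ι (gradR R (F r)) = 0
    rw [presMap_grad h hh hC]
    by_cases hr : r = o
    · rw [hr, ho, map_zero]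
    · obtain ⟨b, hb⟩ := hF r hr
      rw [← hb, ← hh, Derivation.map_algebraMap]

end Kaehler

/-- relations -/
noncomputable def relFam {A : Type*} [CommRing A] {d : ℕ} (c : A)
    (Δ : MvPolynomial (Fin d) A)
    (f : Fin d → MvPolynomial (Fin d) A) :
    Option (Fin d) → MvPolynomial (Option (Fin d)) A
  | none => X none * rename some Δ - C c
  | some j => X none * rename some (f j)

/-- general Jacobian matrix -/
noncomputable def jacMatGen {A : Type*} [CommRing A] {d : ℕ}
    (Δ : MvPolynomial (Fin d) A) (f : Fin d → MvPolynomial (Fin d) A) :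
    Matrix (Fin (d + 1)) (Fin (d + 1)) (MvPolynomial (Fin d) A) :=
  Matrix.of fun i j =>
    Fin.lastCases
      (Fin.lastCases Δ (fun j' => f j') j)
      (fun i' => Fin.lastCases (pderiv i' Δ) (fun j' => pderiv i' (f j')) j) i

lemma pderiv_none_rename {A : Type*} [CommRing A] {d : ℕ} (p : MvPolynomial (Fin d) A) :
    pderiv none (rename (some : Fin d → Option (Fin d)) p) = 0 := by
  induction p using MvPolynomial.induction_on with
  | C a => simp
  | add p q hp hq => simp [hp, hq]
  | mul_X p i hp => simp [hp, Derivation.leibniz]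

lemma relFam_entry {A : Type*} [CommRing A] {d : ℕ} (c : A)
    (Δ : MvPolynomial (Fin d) A)
    (f : Fin d → MvPolynomial (Fin d) A) (i j : Fin (d + 1)) :
    pderiv (finSuccEquivLast i) (relFam c Δ f (finSuccEquivLast j)) =
      (Fin.lastCases 1 (fun _ => X none) i : MvPolynomial (Option (Fin d)) A) *
        rename some (jacMatGen Δ f i j) := by
  refine Fin.lastCases ?_ (fun i => ?_) i <;> refine Fin.lastCases ?_ (fun j => ?_) j <;>
    simp [relFam, jacMatGen, Derivation.leibniz, pderiv_none_rename,
      pderiv_rename (Option.some_injective _)]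

lemma det_aux {S T : Type*} [CommRing S] [CommRing T] {d : ℕ} {ι : Type*} [Fintype ι]
    [DecidableEq ι] (φ : S →+* T) (ε : Fin (d + 1) ≃ ι) (P : Matrix ι ι T)
    (N : Matrix (Fin (d + 1)) (Fin (d + 1)) S) (z : T)
    (hP : ∀ i j, P (ε j) (ε i) =
      (Fin.lastCases 1 (fun _ => z) i : T) * φ (N i j)) :
    P.det = z ^ d * φ N.det := by
  have e1 : P.transpose.submatrix ε ε =
      Matrix.diagonal (fun i : Fin (d + 1) => (Fin.lastCases 1 (fun _ => z) i : T)) *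
        φ.mapMatrix N := by
    ext1 i j
    rw [Matrix.diagonal_mul]
    exact hP i j
  rw [← Matrix.det_transpose P, ← Matrix.det_submatrix_equiv_self ε P.transpose, e1,
    Matrix.det_mul, Matrix.det_diagonal, ← RingHom.map_det, Fin.prod_univ_castSucc]
  simp only [Fin.lastCases_castSucc, Fin.lastCases_last, Finset.prod_const, Finset.card_univ,
    Fintype.card_fin, mul_one]

lemma relFam_det {A : Type*} [CommRing A] {d : ℕ} (c : A)
    (Δ : MvPolynomial (Fin d) A)
    (f : Fin d → MvPolynomial (Fin d) A) :
    (Matrix.of fun r i => pderiv i (relFam c Δ f r)).det =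
      X none ^ d * rename some (jacMatGen Δ f).det :=
  det_aux (rename (some : Fin d → Option (Fin d)) :
    MvPolynomial (Fin d) A →ₐ[A] MvPolynomial (Option (Fin d)) A).toRingHom finSuccEquivLast _ _ _
    (fun i j => relFam_entry c Δ f i j)

lemma grad_mem_span {A R ι κ : Type*} [CommRing A] [CommRing R]
    [Algebra (MvPolynomial ι A) R] (g : κ → MvPolynomial ι A) (K : Submodule R (ι → R))
    (hg : ∀ j, gradR R (g j) ∈ K) (b : MvPolynomial κ A) :
    gradR R (aeval g b) ∈ K := by
  induction b using MvPolynomial.induction_on with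
  | C a =>
    rw [aeval_C, algebraMap_eq, gradR_C]
    exact Submodule.zero_mem _
  | add p q hp hq =>
    rw [map_add, gradR_add]
    exact Submodule.add_mem _ hp hq
  | mul_X p i hp =>
    rw [map_mul, gradR_mul, aeval_X]
    exact Submodule.add_mem _ (Submodule.smul_mem _ _ (hg _)) (Submodule.smul_mem _ _ hp)

lemma fitting_general {A R : Type*} [CommRing A] [CommRing R] {d : ℕ} (c : A)
    (Δ : MvPolynomial (Fin d) A) (f : Fin d → MvPolynomial (Fin d) A)
    [Algebra (MvPolynomial (Option (Fin d)) A) R] [Algebra (MvPolynomial (Fin d) A) R]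
    (hs : Function.Surjective (algebraMap (MvPolynomial (Option (Fin d)) A) R))
    (hker : RingHom.ker (algebraMap (MvPolynomial (Option (Fin d)) A) R) =
      Ideal.span {X none * rename some Δ - C c})
    (hh : ∀ b : MvPolynomial (Fin d) A, algebraMap _ R b =
      algebraMap (MvPolynomial (Option (Fin d)) A) R
        (aeval (fun j : Fin d => X none * rename some (f j)) b)) :
    fittingIdeal R (KaehlerDifferential (MvPolynomial (Fin d) A) R) 0 =
      Ideal.span {algebraMap (MvPolynomial (Option (Fin d)) A) R
        (X none ^ d * rename some (jacMatGen Δ f).det)} := by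
  rw [← relFam_det c]
  refine fitting_kaehler_aux
    (aeval (fun j : Fin d => X none * rename some (f j)) :
      MvPolynomial (Fin d) A →ₐ[A] MvPolynomial (Option (Fin d)) A).toRingHom hh
    (fun a => ⟨C a, ?_⟩) hs (relFam c Δ f) none ?_ ?_ ?_ ?_
  · exact aeval_C _ _
  · rw [← RingHom.mem_ker, hker]
    exact Ideal.subset_span rfl
  · intro p hp
    rw [← RingHom.mem_ker, hker] at hp
    exact Ideal.mem_span_singleton'.1 hp
  · rintro (_ | j) hr
    · exact absurd rfl hr
    · exact ⟨X j, aeval_X _ _⟩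
  · exact grad_mem_span _ _ fun j => Submodule.subset_span ⟨some j, rfl⟩

/-- with `R₂ = k[[t]][x₁,…,x_d,z]/(zΔ - t^e)` regarded as an algebra over
`R₁ = k[[t]][u₁,…,u_d]` via `u_j ↦ z̄·f̄_j`, the 0-th Fitting ideal of `Ω_{R₂/R₁}` is the
principal ideal generated by the image of `z^d · det N`, where `N` is the
`(d+1)×(d+1)` matrix with rows `(∂f₁/∂x_i, …, ∂f_d/∂x_i, ∂Δ/∂x_i)` and last row
`(f₁,…,f_d, Δ)`. -/
theorem fittingIdeal_kaehler_of_translation (k : Type u) [Field k] (d e : ℕ) (hd : 1 ≤ d)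
    (Δ : MvPolynomial (Fin d) (PowerSeries k))
    (f : Fin d → MvPolynomial (Fin d) (PowerSeries k)) :
    letI : Algebra (MvPolynomial (Fin d) (PowerSeries k))
        (MvPolynomial (Option (Fin d)) (PowerSeries k) ⧸ relIdeal k d e Δ) :=
      ((aeval (fun j : Fin d =>
        Ideal.Quotient.mk (relIdeal k d e Δ) (X none * rename some (f j)))).toRingHom).toAlgebra
    fittingIdeal (MvPolynomial (Option (Fin d)) (PowerSeries k) ⧸ relIdeal k d e Δ)
        (KaehlerDifferential (MvPolynomial (Fin d) (PowerSeries k))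
          (MvPolynomial (Option (Fin d)) (PowerSeries k) ⧸ relIdeal k d e Δ)) 0 =
      Ideal.span {Ideal.Quotient.mk (relIdeal k d e Δ)
        (X none ^ d * rename some (jacMat k d Δ f).det)} := by
  letI : Algebra (MvPolynomial (Fin d) (PowerSeries k))
        (MvPolynomial (Option (Fin d)) (PowerSeries k) ⧸ relIdeal k d e Δ) :=
      ((aeval (fun j : Fin d =>
        Ideal.Quotient.mk (relIdeal k d e Δ) (X none * rename some (f j)))).toRingHom).toAlgebra
  refine fitting_general (PowerSeries.X ^ e : PowerSeries k) Δ f Ideal.Quotient.mk_surjective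
    (Ideal.mk_ker) fun b => ?_
  have : aeval (fun j : Fin d =>
      Ideal.Quotient.mk (relIdeal k d e Δ) (X none * rename some (f j))) =
      (Ideal.Quotient.mkₐ (PowerSeries k) (relIdeal k d e Δ)).comp
        (aeval (fun j : Fin d => X none * rename some (f j))) := by
    apply MvPolynomial.algHom_ext
    intro i
    simp
  exact DFunLike.congr_fun this b
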